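/- Fix a real number d > 1 and let H₂ be the subgroup of SL₃(ℝ) consisting of all matrices with rows (d^{−2t}, a, b), (0, d^t cos t, d^t sin t), (0, −d^t sin t, d^t cos t) for t, a, b ∈ ℝ. Let m₁ = [[2,1,0],[1,1,0],[0,0,1]] and m₂ = [[2d^{−4π}, d^{−4π}, 0],[d^{−4π}, (d^{−4π}+d^{2π})/2, 0],[0, 0, d^{2π}]]. Then m₁ ≠ m₂, both m₁ and m₂ are symmetric positive-definite matrices with determinant 1, and both lie in the same left coset m₁·H₂ of H₂ in SL₃(ℝ). -/

import Mathlib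

open Matrix Real

/-- The subgroup `H₂` of `SL₃(ℝ)` from Proposition 12, as a set of matrices. -/
def H2set (d : ℝ) : Set (Matrix (Fin 3) (Fin 3) ℝ) :=
  {A | ∃ t a b : ℝ,
    A = !![d ^ (-(2 * t)), a, b;
           0, d ^ t * Real.cos t, d ^ t * Real.sin t;
           0, -(d ^ t * Real.sin t), d ^ t * Real.cos t]}

/-- The matrix `m₁` of Proposition 12. -/
def matM₁ : Matrix (Fin 3) (Fin 3) ℝ := !![2, 1, 0; 1, 1, 0; 0, 0, 1]

/-- The matrix `m₂` of Proposition 12. -/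
noncomputable def matM₂ (d : ℝ) : Matrix (Fin 3) (Fin 3) ℝ :=
  !![2 * d ^ (-(4 * π)), d ^ (-(4 * π)), 0;
     d ^ (-(4 * π)), (d ^ (-(4 * π)) + d ^ (2 * π)) / 2, 0;
     0, 0, d ^ (2 * π)]

/-- The symmetric matrices below contain both `matM₁` (`p = q = 1`) and `matM₂ d`. -/
theorem posDef_of_pos {p q : ℝ} (hp : 0 < p) (hq : 0 < q) :
    (!![2 * p, p, 0; p, (p + q) / 2, 0; 0, 0, q] : Matrix (Fin 3) (Fin 3) ℝ).PosDef := by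
  refine Matrix.PosDef.of_dotProduct_mulVec_pos ?_ fun x hx => ?_
  · ext i j
    fin_cases i <;> fin_cases j <;> simp
  · have expand : star x ⬝ᵥ (!![2 * p, p, 0; p, (p + q) / 2, 0; 0, 0, q] *ᵥ x) =
        p / 2 * (2 * x 0 + x 1) ^ 2 + q / 2 * x 1 ^ 2 + q * x 2 ^ 2 := by
      simp [dotProduct, mulVec, Fin.sum_univ_three]
      ring
    rw [expand]
    by_cases h2 : x 2 = 0
    · by_cases h1 : x 1 = 0
      · have h0 : x 0 ≠ 0 := fun h0 => hx (by ext i; fin_cases i <;> simp [h0, h1, h2])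
        rw [h1, h2]
        simp only [add_zero]
        positivity
      · positivity
    · positivity

theorem det_of_mul_sq_eq_one {p q : ℝ} (h : p * q ^ 2 = 1) :
    (!![2 * p, p, 0; p, (p + q) / 2, 0; 0, 0, q] : Matrix (Fin 3) (Fin 3) ℝ).det = 1 := by
  simp [det_fin_three]
  linear_combination h

theorem isSymm_of_entries (p q : ℝ) :
    (!![2 * p, p, 0; p, (p + q) / 2, 0; 0, 0, q] : Matrix (Fin 3) (Fin 3) ℝ).IsSymm := by
  ext i j
  fin_cases i <;> fin_cases j <;> simp

theorem matM₁_eq :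
    matM₁ = !![2 * 1, 1, 0; 1, (1 + 1) / 2, 0; 0, 0, 1] := by
  norm_num [matM₁]

/-- Key computation in the proof of Proposition 12: `m₁ ≠ m₂`, both are symmetric
positive-definite of determinant `1`, and both lie in the left coset `m₁·H₂`. -/
theorem coset_contains_two_posdef_elements (d : ℝ) (hd : 1 < d) :
    matM₁ ≠ matM₂ d ∧
    (matM₁.IsSymm ∧ matM₁.PosDef ∧ matM₁.det = 1) ∧
    ((matM₂ d).IsSymm ∧ (matM₂ d).PosDef ∧ (matM₂ d).det = 1) ∧
    (∃ h ∈ H2set d, matM₁ = matM₁ * h) ∧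
    (∃ h ∈ H2set d, matM₂ d = matM₁ * h) := by
  have hd0 : 0 < d := by linarith
  have hp : 0 < d ^ (-(4 * π)) := rpow_pos_of_pos hd0 _
  have hq : 0 < d ^ (2 * π) := rpow_pos_of_pos hd0 _
  have hpq : d ^ (-(4 * π)) * (d ^ (2 * π)) ^ 2 = 1 := by
    rw [← rpow_mul_natCast hd0.le, ← rpow_add hd0,
      show -(4 * π) + 2 * π * (2 : ℕ) = 0 by push_cast; ring, rpow_zero]
  refine ⟨fun h => ?_, ⟨?_, ?_, ?_⟩, ⟨isSymm_of_entries _ _, posDef_of_pos hp hq,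
    det_of_mul_sq_eq_one hpq⟩, ⟨1, ⟨0, 0, 0, ?_⟩, (mul_one _).symm⟩, ⟨_, ⟨2 * π,
      (d ^ (-(4 * π)) - d ^ (2 * π)) / 2, 0, rfl⟩, ?_⟩⟩
  · have h22 : 1 = d ^ (2 * π) := by simpa [matM₁, matM₂] using congr_fun₂ h 2 2
    exact (one_lt_rpow hd two_pi_pos).ne h22
  · rw [matM₁_eq]
    exact isSymm_of_entries 1 1
  · rw [matM₁_eq]
    exact posDef_of_pos one_pos one_pos
  · rw [matM₁_eq]
    exact det_of_mul_sq_eq_one (by norm_num)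
  · simp [one_fin_three]
  · rw [show -(2 * (2 * π)) = -(4 * π) by ring, cos_two_pi, sin_two_pi]
    ext i j
    fin_cases i <;> fin_cases j <;>
      simp [matM₁, matM₂, mul_apply, Fin.sum_univ_three] <;> ring
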